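/- For all extended regexes R, S and all valid locations x and y: x ⇒_{R·S} y if and only if there exists a valid location z such that x ⇒_R z and z ⇒_S y. -/

import Mathlib

/-- A location in a string: the string together with a position. -/
structure Loc (σ : Type) where
  s : List σ
  i : ℕ

namespace Loc
variable {σ : Type}
/-- A location ⟨s,i⟩ is valid if 0 ≤ i ≤ |s|. -/
def Valid (x : Loc σ) : Prop := x.i ≤ x.s.length
/-- A location is final if i = |s|. -/
def IsFinal (x : Loc σ) : Prop := x.i = x.s.length
/-- ⟨s,i⟩ + 1 = ⟨s,i+1⟩. -/
def next (x : Loc σ) : Loc σ := ⟨x.s, x.i + 1⟩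
/-- Reversal of a valid location: r(⟨s,i⟩) = ⟨r(s), |s|-i⟩. -/
def rev (x : Loc σ) : Loc σ := ⟨x.s.reverse, x.s.length - x.i⟩
end Loc

/-- Extended regexes over a type `π` of predicates. -/
inductive Regex (π : Type) : Type where
  | pred (p : π)                               -- ψ
  | eps                                        -- ()
  | union (R S : Regex π)                      -- R|S
  | inter (R S : Regex π)                      -- R&S
  | cat (R S : Regex π)                        -- R·S
  | loop (R : Regex π) (m : ℕ) (n : ℕ∞)        -- R{m,n}
  | compl (R : Regex π)                        -- ~R
  | la (R : Regex π)                           -- (?=R)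
  | lb (R : Regex π)                           -- (?<=R)
  | nla (R : Regex π)                          -- (?!R)
  | nlb (R : Regex π)                          -- (?<!R)

namespace Regex
variable {σ π : Type}

/-- Reversal of a regex. -/
def rev : Regex π → Regex π
  | pred p => pred p
  | eps => eps
  | union R S => union R.rev S.rev
  | inter R S => inter R.rev S.rev
  | cat R S => cat S.rev R.rev
  | loop R m n => loop R.rev m n
  | compl R => compl R.rev
  | la R => lb R.rev
  | lb R => la R.rev
  | nla R => nlb R.rev
  | nlb R => nla R.rev

/-- Size: number of subexpressions (each predicate has size 1). -/
def size : Regex π → ℕ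
  | pred _ => 1
  | eps => 1
  | union R S => R.size + S.size + 1
  | inter R S => R.size + S.size + 1
  | cat R S => R.size + S.size + 1
  | loop R _ _ => R.size + 1
  | compl R => R.size + 1
  | la R => R.size + 1
  | lb R => R.size + 1
  | nla R => R.size + 1
  | nlb R => R.size + 1

/-- Lookaround nesting depth (used only for termination). -/
def depth : Regex π → ℕ
  | pred _ => 0
  | eps => 0
  | union R S => max R.depth S.depth
  | inter R S => max R.depth S.depth
  | cat R S => max R.depth S.depth
  | loop R _ _ => R.depth
  | compl R => R.depth
  | la R => R.depth + 1
  | lb R => R.depth + 1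
  | nla R => R.depth + 1
  | nlb R => R.depth + 1

/-- Weight (used only for termination). -/
def weight : Regex π → ℕ
  | pred _ => 1
  | eps => 1
  | union R S => R.weight + S.weight + 1
  | inter R S => R.weight + S.weight + 1
  | cat R S => R.weight + S.weight + 1
  | loop R m _ => (m + 2) * (R.weight + 2)
  | compl R => R.weight + 1
  | la R => R.weight + 1
  | lb R => R.weight + 1
  | nla R => R.weight + 1
  | nlb R => R.weight + 1

theorem depth_rev (R : Regex π) : R.rev.depth = R.depth := by
  induction R <;> simp [rev, depth, *] <;> omega

theorem weight_lt_loop (R : Regex π) (m : ℕ) (n : ℕ∞) : R.weight < (loop R m n).weight := by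
  simp only [weight]
  have h2 : 2 * (R.weight + 2) ≤ (m + 2) * (R.weight + 2) :=
    Nat.mul_le_mul_right _ (by omega)
  linarith

theorem cat_loop_weight_lt (R : Regex π) (m : ℕ) (n : ℕ∞) (hm : m ≠ 0) :
    (cat R (loop R (m - 1) (n - 1))).weight < (loop R m n).weight := by
  simp only [weight]
  have e : m - 1 + 2 = m + 1 := by omega
  rw [e]
  have e2 : (m + 2) * (R.weight + 2) = (m + 1) * (R.weight + 2) + (R.weight + 2) := by ring
  linarith

/-- A regex is a lookaround if it has one of the forms (?=R), (?<=R), (?!R), (?<!R). -/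
def IsLookaround : Regex π → Prop
  | la _ => True
  | lb _ => True
  | nla _ => True
  | nlb _ => True
  | _ => False

end Regex


theorem lex4_of {a₁ a₂ b₁ b₂ c₁ c₂ d₁ d₂ : ℕ}
    (h : a₁ < a₂ ∨ a₁ = a₂ ∧ (b₁ < b₂ ∨ b₁ = b₂ ∧ (c₁ < c₂ ∨ c₁ = c₂ ∧ d₁ < d₂))) :
    Prod.Lex (· < ·) (Prod.Lex (· < ·) (Prod.Lex (· < ·) (· < ·)))
      (a₁, b₁, c₁, d₁) (a₂, b₂, c₂, d₂) := by
  rcases h with h | ⟨rfl, h | ⟨rfl, h | ⟨rfl, h⟩⟩⟩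
  · exact Prod.Lex.left _ _ h
  · exact Prod.Lex.right _ (Prod.Lex.left _ _ h)
  · exact Prod.Lex.right _ (Prod.Lex.right _ (Prod.Lex.left _ _ h))
  · exact Prod.Lex.right _ (Prod.Lex.right _ (Prod.Lex.right _ h))

open Regex

variable {σ π : Type}

open Classical in
mutual
/-- Nullability `Null_x(R)` of regex `R` at location `x`.
`den` is the denotation function of predicates; `pbot` is the bottom predicate ⊥. -/
noncomputable def Null (den : π → Set σ) (pbot : π) (x : Loc σ) : Regex π → Prop
  | .pred _ => False
  | .eps => True
  | .union R S => Null den pbot x R ∨ Null den pbot x S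
  | .inter R S => Null den pbot x R ∧ Null den pbot x S
  | .cat R S => Null den pbot x R ∧ Null den pbot x S
  | .loop R m _ => m = 0 ∨ Null den pbot x R
  | .compl R => ¬ Null den pbot x R
  | .la R => (FAM den pbot x R).Nonempty
  | .lb R => (FAM den pbot x.rev R.rev).Nonempty
  | .nla R => ¬ (FAM den pbot x R).Nonempty
  | .nlb R => ¬ (FAM den pbot x.rev R.rev).Nonempty
termination_by R => (R.depth, 0, x.s.length - x.i, R.weight)
decreasing_by all_goals
  · apply lex4_of
    first
    | (try simp only [Regex.depth, Regex.weight, Regex.depth_rev, Loc.next, Loc.rev,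
        max_self, true_and, and_true]
       omega)
    | exact Or.inr ⟨rfl, Or.inr ⟨rfl, Or.inr ⟨rfl, Regex.weight_lt_loop _ _ _⟩⟩⟩
    | exact Or.inr ⟨rfl, Or.inl (by omega)⟩
    | (refine Or.inr ⟨by simp [Regex.depth], Or.inr ⟨rfl, Or.inr ⟨rfl,
         Regex.cat_loop_weight_lt _ _ _ ?_⟩⟩⟩
       rename_i h
       exact fun hm => h (Or.inl hm))

/-- Location derivative `δ_x(R)`, bundled with a proof that derivatives do
not increase lookaround depth (needed for termination). -/
noncomputable def Der (den : π → Set σ) (pbot : π) (x : Loc σ) :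
    (R : Regex π) → {S : Regex π // S.depth ≤ R.depth}
  | .pred p =>
      ⟨if h : x.i < x.s.length then
          (if x.s[x.i] ∈ den p then .eps else .pred pbot)
        else .pred pbot, by split_ifs <;> simp [Regex.depth]⟩
  | .eps => ⟨.pred pbot, Nat.zero_le _⟩
  | .union R S =>
      let dR := Der den pbot x R
      let dS := Der den pbot x S
      ⟨.union dR.1 dS.1, max_le_max dR.2 dS.2⟩
  | .inter R S =>
      let dR := Der den pbot x R
      let dS := Der den pbot x S
      ⟨.inter dR.1 dS.1, max_le_max dR.2 dS.2⟩
  | .cat R S =>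
      let dR := Der den pbot x R
      if Null den pbot x R then
        let dS := Der den pbot x S
        ⟨.union (.cat dR.1 S) dS.1,
          max_le (max_le_max dR.2 le_rfl) (dS.2.trans (le_max_right _ _))⟩
      else
        ⟨.cat dR.1 S, max_le_max dR.2 le_rfl⟩
  | .loop R m n =>
      if m = 0 ∨ (∀ y : Loc σ, y.Valid → Null den pbot y R) ∨ ¬ Null den pbot x R then
        let dR := Der den pbot x R
        ⟨.cat dR.1 (.loop R (m - 1) (n - 1)), max_le dR.2 le_rfl⟩
      else
        let d := Der den pbot x (.cat R (.loop R (m - 1) (n - 1)))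
        ⟨d.1, d.2.trans (by simp [Regex.depth])⟩
  | .compl R =>
      let dR := Der den pbot x R
      ⟨.compl dR.1, dR.2⟩
  | .la _ => ⟨.pred pbot, Nat.zero_le _⟩
  | .lb _ => ⟨.pred pbot, Nat.zero_le _⟩
  | .nla _ => ⟨.pred pbot, Nat.zero_le _⟩
  | .nlb _ => ⟨.pred pbot, Nat.zero_le _⟩
termination_by R => (R.depth, 1, x.s.length - x.i, R.weight)
decreasing_by all_goals
  · apply lex4_of
    first
    | (try simp only [Regex.depth, Regex.weight, Regex.depth_rev, Loc.next, Loc.rev,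
        max_self, true_and, and_true]
       omega)
    | exact Or.inr ⟨rfl, Or.inr ⟨rfl, Or.inr ⟨rfl, Regex.weight_lt_loop _ _ _⟩⟩⟩
    | exact Or.inr ⟨rfl, Or.inl (by omega)⟩
    | (refine Or.inr ⟨by simp [Regex.depth], Or.inr ⟨rfl, Or.inr ⟨rfl,
         Regex.cat_loop_weight_lt _ _ _ ?_⟩⟩⟩
       rename_i h
       exact fun hm => h (Or.inl hm))

/-- `FindAllMatches(x, R)`: the set of all match-end locations for `R` from `x`. -/
noncomputable def FAM (den : π → Set σ) (pbot : π) (x : Loc σ) (R : Regex π) : Set (Loc σ) :=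
  (if Null den pbot x R then {x} else ∅) ∪
    (if x.i < x.s.length then
      match Der den pbot x R with
      | ⟨S, _⟩ => FAM den pbot x.next S
    else ∅)
termination_by (R.depth, 2, x.s.length - x.i, R.weight)
decreasing_by all_goals
  · apply lex4_of
    first
    | (try simp only [Regex.depth, Regex.weight, Regex.depth_rev, Loc.next, Loc.rev,
        max_self, true_and, and_true]
       omega)
    | exact Or.inr ⟨rfl, Or.inr ⟨rfl, Or.inr ⟨rfl, Regex.weight_lt_loop _ _ _⟩⟩⟩
    | exact Or.inr ⟨rfl, Or.inl (by omega)⟩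
    | (refine Or.inr ⟨by simp [Regex.depth], Or.inr ⟨rfl, Or.inr ⟨rfl,
         Regex.cat_loop_weight_lt _ _ _ ?_⟩⟩⟩
       rename_i h
       exact fun hm => h (Or.inl hm))
end

/-- `IsMatch(x, R)` holds iff `FindAllMatches(x, R)` is nonempty. -/
def IsMatch (den : π → Set σ) (pbot : π) (x : Loc σ) (R : Regex π) : Prop :=
  (FAM den pbot x R).Nonempty

/-- The derivation relation x ⇒_R y: y ∈ FindAllMatches(x, R). -/
def Derives (den : π → Set σ) (pbot : π) (x : Loc σ) (R : Regex π) (y : Loc σ) : Prop :=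
  y ∈ FAM den pbot x R

/-- Regex equivalence: R ≡ S iff they derive exactly the same pairs of valid locations. -/
def REquiv (den : π → Set σ) (pbot : π) (R S : Regex π) : Prop :=
  ∀ x y : Loc σ, x.Valid → y.Valid →
    (Derives den pbot x R y ↔ Derives den pbot x S y)

open Classical in
/-- `FindMatchEnd(x, R)`: the maximal (by position) location in `FindAllMatches(x, R)`,
or failure (`none`) if that set is empty. -/
noncomputable def FindMatchEnd (den : π → Set σ) (pbot : π) (x : Loc σ) (R : Regex π) :
    Option (Loc σ) :=
  if (FAM den pbot x R).Nonempty then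
    some ⟨x.s, sSup {j : ℕ | Loc.mk x.s j ∈ FAM den pbot x R}⟩
  else none

/-- The top-level matcher `llMatch(s, R)`:
first find the match end of `⊤*·r(R)` in the reversed string, then, reversing
the resulting location, find the match end of `R` from there. `ptop` is the top predicate. -/
noncomputable def llMatch (den : π → Set σ) (pbot ptop : π) (s : List σ) (R : Regex π) :
    Option (Loc σ × Loc σ) :=
  match FindMatchEnd den pbot ⟨s.reverse, 0⟩
      (Regex.cat (Regex.loop (Regex.pred ptop) 0 ⊤) R.rev) with
  | none => none
  | some x => (FindMatchEnd den pbot x.rev R).map (fun y => (x.rev, y))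

theorem derives_iff_null_or_next {σ π : Type} (den : π → Set σ) (pbot : π) (x y : Loc σ)
    (R : Regex π) :
    Derives den pbot x R y ↔
      (Null den pbot x R ∧ y = x) ∨
        (x.i < x.s.length ∧ Derives den pbot x.next (Der den pbot x R).1 y) := by
  unfold Derives
  rw [FAM]
  split_ifs <;> simp [*]

theorem derives_union_iff {σ π : Type} (den : π → Set σ) (pbot : π) (R S : Regex π)
    (x y : Loc σ) :
    Derives den pbot x (.union R S) y ↔ Derives den pbot x R y ∨ Derives den pbot x S y := by
  induction h : x.s.length - x.i generalizing x R S with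
  | zero =>
    have hlt : ¬ x.i < x.s.length := by omega
    simp only [derives_iff_null_or_next den pbot x, Null, hlt]
    tauto
  | succ n ih =>
    have ih := fun R S => ih R S x.next (by simp only [Loc.next]; omega)
    rw [derives_iff_null_or_next den pbot x, derives_iff_null_or_next den pbot x _ R,
      derives_iff_null_or_next den pbot x _ S, Null, Der, ih]
    tauto

theorem Derives.valid {σ π : Type} {den : π → Set σ} {pbot : π} {R : Regex π} {x y : Loc σ}
    (hx : x.Valid) (h : Derives den pbot x R y) : y.Valid := by
  induction hn : x.s.length - x.i generalizing x R with
  | zero =>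
    rcases (derives_iff_null_or_next ..).1 h with ⟨_, rfl⟩ | ⟨hlt, _⟩
    · exact hx
    · omega
  | succ n ih =>
    rcases (derives_iff_null_or_next ..).1 h with ⟨_, rfl⟩ | ⟨hlt, h⟩
    · exact hx
    · exact ih (x := x.next) hlt h (by simp only [Loc.next]; omega)

theorem derives_cat_iff_exists {σ π : Type} (den : π → Set σ) (pbot : π) (R S : Regex π)
    (x y : Loc σ) :
    Derives den pbot x (.cat R S) y ↔
      ∃ z : Loc σ, Derives den pbot x R z ∧ Derives den pbot z S y := by
  have key : ∀ (R : Regex π) (x : Loc σ),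
      (∃ z, Derives den pbot x R z ∧ Derives den pbot z S y) ↔
        (Null den pbot x R ∧ Derives den pbot x S y) ∨
          (x.i < x.s.length ∧
            ∃ z, Derives den pbot x.next (Der den pbot x R).1 z ∧ Derives den pbot z S y) := by
    intro R x
    simp only [derives_iff_null_or_next den pbot x _ R, or_and_right, exists_or, and_assoc,
      exists_and_left, exists_eq_left]
  induction h : x.s.length - x.i generalizing x R with
  | zero =>
    have hlt : ¬ x.i < x.s.length := by omega
    rw [key, derives_iff_null_or_next, derives_iff_null_or_next den pbot x _ S, Null]
    tauto
  | succ n ih =>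
    have ih := (ih (Der den pbot x R).1 x.next (by simp only [Loc.next]; omega)).symm
    rw [key, ih, derives_iff_null_or_next, derives_iff_null_or_next den pbot x _ S, Null, Der]
    by_cases hN : Null den pbot x R
    · simp only [hN, if_true, derives_union_iff]
      tauto
    · simp only [hN, if_false]
      tauto

/-- x ⇒_{R·S} y iff there exists a valid location z with x ⇒_R z and z ⇒_S y. -/
theorem derives_cat_iff {σ π : Type} (den : π → Set σ) (pbot : π) (hbot : den pbot = ∅)
    (R S : Regex π) (x y : Loc σ) (hx : x.Valid) (hy : y.Valid) :
    Derives den pbot x (Regex.cat R S) y ↔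
      ∃ z : Loc σ, z.Valid ∧ Derives den pbot x R z ∧ Derives den pbot z S y := by
  rw [derives_cat_iff_exists]
  exact exists_congr fun z => ⟨fun h => ⟨h.1.valid hx, h⟩, And.right⟩
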